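/- Let L be a connected simple graph on a finite vertex type V, let M := lapMatrix(L), let v ≠ w be two vertices and S := {v,w}. Let u ∈ ℝ^V be any vector with M·u = e_w − e_v (such u exists since L is connected), and set R := (e_w − e_v) ⬝ u, the effective resistance R_{v,w}^L between v and w (its value is independent of the choice of u). Let X be any matrix with M(Sᶜ,Sᶜ)·X = M(Sᶜ,S) and N := M(S,S) − M(S,Sᶜ)·X, the 2×2 persistent Laplacian Δ₀^{S,L}. Then R > 0 and N(v,v) = N(w,w) = 1/R and N(v,w) = N(w,v) = −1/R. -/

import Mathlib

open Matrix

/-- The vector equal to the `s`-th coordinate vector on `S` and to the column `-X(·,s)` on `Sᶜ`. -/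
def Matrix.schurExtension {V : Type*} [Fintype V] [DecidableEq V] {S : Finset V}
    (X : Matrix ↥Sᶜ ↥S ℝ) (s : ↥S) (x : V) : ℝ :=
  if h : x ∈ S then (Pi.single s 1 : ↥S → ℝ) ⟨x, h⟩ else -X ⟨x, Finset.mem_compl.2 h⟩ s

theorem Matrix.schurExtension_coe {V : Type*} [Fintype V] [DecidableEq V] {S : Finset V}
    (X : Matrix ↥Sᶜ ↥S ℝ) (s x : ↥S) :
    X.schurExtension s x = (Pi.single s 1 : ↥S → ℝ) x := by
  simp [schurExtension]

theorem Matrix.schurExtension_coe_compl {V : Type*} [Fintype V] [DecidableEq V] {S : Finset V}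
    (X : Matrix ↥Sᶜ ↥S ℝ) (s : ↥S) (x : ↥Sᶜ) : X.schurExtension s x = -X x s := by
  simp [schurExtension, Finset.mem_compl.1 x.2]

theorem Matrix.mulVec_schurExtension {V : Type*} [Fintype V] [DecidableEq V] {S : Finset V}
    (M : Matrix V V ℝ) (X : Matrix ↥Sᶜ ↥S ℝ) (s : ↥S) (x : V) :
    (M *ᵥ X.schurExtension s) x = M x s - ∑ y : ↥Sᶜ, M x y * X y s := by
  rw [mulVec, dotProduct, ← Finset.sum_add_sum_compl S, ← Finset.sum_coe_sort S,
    ← Finset.sum_coe_sort Sᶜ]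
  simp [schurExtension_coe, schurExtension_coe_compl, Pi.single_apply, sub_eq_add_neg]

/-- A Schur complement column is recovered by applying `M` to the corresponding extension. -/
theorem Matrix.mulVec_schurExtension_coe {V : Type*} [Fintype V] [DecidableEq V] {S : Finset V}
    (M : Matrix V V ℝ) (X : Matrix ↥Sᶜ ↥S ℝ) (s x : ↥S) :
    (M *ᵥ X.schurExtension s) x =
      (M.submatrix (Subtype.val : ↥S → V) (Subtype.val : ↥S → V) -
        M.submatrix (Subtype.val : ↥S → V) (Subtype.val : ↥Sᶜ → V) * X) x s := by
  rw [mulVec_schurExtension]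
  simp [mul_apply]

theorem Matrix.mulVec_schurExtension_eq_zero {V : Type*} [Fintype V] [DecidableEq V]
    {S : Finset V} (M : Matrix V V ℝ) (X : Matrix ↥Sᶜ ↥S ℝ)
    (hX : M.submatrix (Subtype.val : ↥Sᶜ → V) (Subtype.val : ↥Sᶜ → V) * X =
      M.submatrix (Subtype.val : ↥Sᶜ → V) (Subtype.val : ↥S → V))
    (s : ↥S) {x : V} (hx : x ∉ S) : (M *ᵥ X.schurExtension s) x = 0 := by
  have h := congrFun (congrFun hX ⟨x, Finset.mem_compl.2 hx⟩) s
  simp only [mul_apply, submatrix_apply] at h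
  rw [mulVec_schurExtension, h, sub_self]

/-- If `L f` is supported on `{v, w}`, it is a multiple of `e_w - e_v`, and the potential drop of
`f` is this multiple times the effective resistance. -/
theorem SimpleGraph.potential_drop_of_lapMatrix_mulVec {V : Type*} [Fintype V] [DecidableEq V]
    (L : SimpleGraph V) [DecidableRel L.Adj] {v w : V} (hvw : v ≠ w) {u f : V → ℝ}
    (hu : L.lapMatrix ℝ *ᵥ u = Pi.single w 1 - Pi.single v 1)
    (hf : ∀ x ∉ ({v, w} : Finset V), (L.lapMatrix ℝ *ᵥ f) x = 0) :
    (L.lapMatrix ℝ *ᵥ f) v = -(L.lapMatrix ℝ *ᵥ f) w ∧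
      f w - f v = (L.lapMatrix ℝ *ᵥ f) w * (u w - u v) := by
  have dot (g : V → ℝ) : g ⬝ᵥ (L.lapMatrix ℝ *ᵥ f) =
      g v * (L.lapMatrix ℝ *ᵥ f) v + g w * (L.lapMatrix ℝ *ᵥ f) w := by
    rw [dotProduct, ← Finset.sum_subset (Finset.subset_univ {v, w})
      fun x _ hx ↦ by rw [hf x hx, mul_zero], Finset.sum_pair hvw]
  have adj (g : V → ℝ) : g ⬝ᵥ (L.lapMatrix ℝ *ᵥ f) = (L.lapMatrix ℝ *ᵥ g) ⬝ᵥ f := by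
    rw [dotProduct_mulVec, ← mulVec_transpose, L.isSymm_lapMatrix ℝ]
  have h1 := (dot fun _ ↦ 1).symm.trans (adj fun _ ↦ 1)
  rw [L.lapMatrix_mulVec_const_eq_zero, zero_dotProduct, one_mul, one_mul] at h1
  have h2 := (dot u).symm.trans (adj u)
  rw [hu, sub_dotProduct, single_one_dotProduct, single_one_dotProduct] at h2
  have h3 := eq_neg_of_add_eq_zero_left h1
  refine ⟨h3, ?_⟩
  rw [← h2, h3]
  ring

/-- **The two-point persistent Laplacian in terms of effective resistance.**
For a connected graph `L` and distinct vertices `v, w`, with `S = {v, w}`,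
`R = R_{v,w}^L` the effective resistance (computed from any solution `u` of
`M·u = e_w − e_v` for the Laplacian `M = lapMatrix L`), the `2 × 2` persistent Laplacian
`N = Δ₀^{S,L}` satisfies `R > 0`, `N(v,v) = N(w,w) = 1/R` and `N(v,w) = N(w,v) = −1/R`. -/
theorem two_point_persistent_laplacian_eq_inv_effective_resistance
    {V : Type*} [Fintype V] [DecidableEq V]
    (L : SimpleGraph V) [DecidableRel L.Adj] (hL : L.Connected)
    (v w : V) (hvw : v ≠ w)
    (u : V → ℝ) (hu : (L.lapMatrix ℝ).mulVec u = Pi.single w 1 - Pi.single v 1)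
    (R : ℝ) (hR : R = (Pi.single w 1 - Pi.single v 1) ⬝ᵥ u)
    (X : Matrix ↥({v, w} : Finset V)ᶜ ↥({v, w} : Finset V) ℝ)
    (hX : (L.lapMatrix ℝ).submatrix
          (Subtype.val : ↥({v, w} : Finset V)ᶜ → V)
          (Subtype.val : ↥({v, w} : Finset V)ᶜ → V) * X =
        (L.lapMatrix ℝ).submatrix
          (Subtype.val : ↥({v, w} : Finset V)ᶜ → V)
          (Subtype.val : ↥({v, w} : Finset V) → V))
    (N : Matrix ↥({v, w} : Finset V) ↥({v, w} : Finset V) ℝ)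
    (hN : N = (L.lapMatrix ℝ).submatrix
          (Subtype.val : ↥({v, w} : Finset V) → V)
          (Subtype.val : ↥({v, w} : Finset V) → V) -
        (L.lapMatrix ℝ).submatrix
          (Subtype.val : ↥({v, w} : Finset V) → V)
          (Subtype.val : ↥({v, w} : Finset V)ᶜ → V) * X) :
    0 < R ∧
    N ⟨v, by simp⟩ ⟨v, by simp⟩ = 1 / R ∧
    N ⟨w, by simp⟩ ⟨w, by simp⟩ = 1 / R ∧
    N ⟨v, by simp⟩ ⟨w, by simp⟩ = -(1 / R) ∧
    N ⟨w, by simp⟩ ⟨v, by simp⟩ = -(1 / R) := by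
  have hRu : R = u w - u v := by
    rw [hR, sub_dotProduct, single_one_dotProduct, single_one_dotProduct]
  have hR0 : 0 ≤ R := by
    have h := (L.posSemidef_lapMatrix ℝ).dotProduct_mulVec_nonneg u
    rwa [star_trivial, hu, dotProduct_comm, ← hR] at h
  have col (s : ↥({v, w} : Finset V)) := L.potential_drop_of_lapMatrix_mulVec hvw hu
    fun x hx ↦ mulVec_schurExtension_eq_zero _ X hX s hx
  have entry (x s : ↥({v, w} : Finset V)) :
      (L.lapMatrix ℝ *ᵥ X.schurExtension s) x = N x s := by
    rw [mulVec_schurExtension_coe, hN]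
  set v' : ↥({v, w} : Finset V) := ⟨v, by simp⟩
  set w' : ↥({v, w} : Finset V) := ⟨w, by simp⟩
  have hne : v' ≠ w' := fun h ↦ hvw (congrArg Subtype.val h)
  have col' (s : ↥({v, w} : Finset V)) : N v' s = -N w' s ∧
      (Pi.single s 1 : ↥({v, w} : Finset V) → ℝ) w' -
        (Pi.single s 1 : ↥({v, w} : Finset V) → ℝ) v' = N w' s * R := by
    rw [← entry, ← entry, ← schurExtension_coe X, ← schurExtension_coe X, hRu]
    exact col s
  obtain ⟨hv, hv'⟩ := col' v'
  obtain ⟨hw, hw'⟩ := col' w'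
  simp only [Pi.single_eq_same, Pi.single_eq_of_ne hne, Pi.single_eq_of_ne hne.symm, zero_sub,
    sub_zero] at hv' hw'
  have hRne : R ≠ 0 := by
    rintro rfl
    simp at hw'
  have hww : N w' w' = 1 / R := eq_div_of_mul_eq hRne hw'.symm
  have hwv : N w' v' = -(1 / R) := by
    rw [← neg_div]
    exact eq_div_of_mul_eq hRne hv'.symm
  exact ⟨hR0.lt_of_ne' hRne, by rw [hv, hwv, neg_neg], hww, by rw [hw, hww], hwv⟩
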